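/- Uniform characteristic-function gap for the one-site equilibria: fix g : ℕ → ℝ with g(0) = 0, g(k) > 0 for k ≥ 1, satisfying the gap condition, and fix 0 < λ₀ ≤ λ₁ and δ ∈ (0, π]. Then there exists β ∈ (0,1) such that for every λ ∈ [λ₀, λ₁] and every t ∈ ℝ with δ ≤ |t| ≤ π, one has | Σ_{k≥0} n_λ(k) e^{i k t} |² ≤ 1 − β. -/

import Mathlib

open Finset Real

/-- `gFact g k = g(k)! := g(1)g(2)⋯g(k)`, with `g(0)! = 1`. -/
noncomputable def gFact (g : ℕ → ℝ) : ℕ → ℝ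
  | 0 => 1
  | k + 1 => gFact g k * g (k + 1)

/-- The partition function `Z(λ) = Σ_k λ^k / g(k)!`. -/
noncomputable def Zfun (g : ℕ → ℝ) (l : ℝ) : ℝ := ∑' k : ℕ, l ^ k / gFact g k

/-- The mean density `R(λ) = Σ_k k λ^k / (g(k)! Z(λ))`. -/
noncomputable def Rfun (g : ℕ → ℝ) (l : ℝ) : ℝ :=
  ∑' k : ℕ, (k : ℝ) * l ^ k / (gFact g k * Zfun g l)

/-- The one-site equilibrium weight `n_λ(k) = λ^k / (g(k)! Z(λ))`. -/
noncomputable def nWeight (g : ℕ → ℝ) (l : ℝ) (k : ℕ) : ℝ := l ^ k / (gFact g k * Zfun g l)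

/-- The gap condition on the jump rate `g`: there are `n₀` and `c_g > 0` with
`g(n') − g(n) ≥ c_g` whenever `n' ≥ n + n₀`. -/
def GapCondition (g : ℕ → ℝ) : Prop :=
  ∃ n₀ : ℕ, ∃ cg : ℝ, 0 < cg ∧ ∀ n n' : ℕ, n + n₀ ≤ n' → cg ≤ g n' - g n

lemma gFact_pos {g : ℕ → ℝ} (hgpos : ∀ k : ℕ, 0 < k → 0 < g k) (k : ℕ) : 0 < gFact g k := by
  induction k with
  | zero => exact one_pos
  | succ k ih => exact mul_pos ih (hgpos _ k.succ_pos)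

lemma GapCondition.tendsto_atTop {g : ℕ → ℝ} (hg0 : g 0 = 0) (hgap : GapCondition g) :
    Filter.Tendsto g Filter.atTop Filter.atTop := by
  obtain ⟨n₀, c, hc, h⟩ := hgap
  have hmul : ∀ m : ℕ, m * c ≤ g (m * n₀) := by
    intro m
    induction m with
    | zero => simp [hg0]
    | succ m ih =>
      have := h (m * n₀) ((m + 1) * n₀) (by rw [add_mul, one_mul])
      push_cast
      linarith
  refine Filter.tendsto_atTop.2 fun b => ?_
  obtain ⟨m, hm⟩ := exists_nat_ge (b / c)
  filter_upwards [Filter.eventually_ge_atTop (m * n₀ + n₀)] with n hn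
  have h1 := h _ _ hn
  have h2 := hmul m
  rw [div_le_iff₀ hc] at hm
  linarith

lemma summable_pow_div_gFact {g : ℕ → ℝ} (hgpos : ∀ k : ℕ, 0 < k → 0 < g k)
    (hg : Filter.Tendsto g Filter.atTop Filter.atTop) {l : ℝ} (hl : 0 < l) :
    Summable fun k : ℕ => l ^ k / gFact g k := by
  refine summable_of_ratio_norm_eventually_le (r := 1 / 2) (by norm_num) ?_
  filter_upwards [(hg.comp (Filter.tendsto_add_atTop_nat 1)).eventually_ge_atTop (2 * l)]
    with k hk
  have hF := gFact_pos hgpos k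
  have hg' := hgpos (k + 1) k.succ_pos
  have hk' : 2 * l ≤ g (k + 1) := hk
  rw [Real.norm_of_nonneg (div_pos (pow_pos hl _) (gFact_pos hgpos _)).le,
    Real.norm_of_nonneg (div_pos (pow_pos hl _) hF).le]
  have heq : l ^ (k + 1) / gFact g (k + 1) = l / g (k + 1) * (l ^ k / gFact g k) := by
    rw [gFact, pow_succ', mul_comm (gFact g k), mul_div_mul_comm]
  rw [heq]
  refine mul_le_mul_of_nonneg_right ?_ (div_pos (pow_pos hl _) hF).le
  rw [div_le_div_iff₀ hg' two_pos]
  linarith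

lemma norm_add_mul_exp_le {a b : ℝ} (ha : 0 ≤ a) (hb : 0 ≤ b) (hab : a + b ≤ 1) (t : ℝ) :
    ‖(a : ℂ) + b * Complex.exp (Complex.I * t)‖ ≤ a + b - a * b * (1 - cos t) := by
  have hc := neg_one_le_cos t
  have hc' := cos_le_one t
  have hsq : ‖(a : ℂ) + b * Complex.exp (Complex.I * t)‖ ^ 2
      = (a + b) ^ 2 - 2 * (a * b * (1 - cos t)) := by
    rw [mul_comm Complex.I, Complex.exp_mul_I, ← Complex.normSq_eq_norm_sq,
      Complex.normSq_apply, ← Complex.ofReal_cos, ← Complex.ofReal_sin]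
    simp only [Complex.add_re, Complex.add_im, Complex.mul_re, Complex.mul_im, Complex.ofReal_re,
      Complex.ofReal_im, Complex.I_re, Complex.I_im]
    linear_combination b ^ 2 * sin_sq_add_cos_sq t
  have hd : 0 ≤ a * b * (1 - cos t) := mul_nonneg (mul_nonneg ha hb) (by linarith)
  have hd' : a * b * (1 - cos t) ≤ a + b := by
    have : a * b * (1 - cos t) ≤ a * b * 2 := by gcongr; linarith
    nlinarith
  refine le_of_sq_le_sq ?_ (by linarith)
  rw [hsq]
  nlinarith [sq_nonneg (a * b * (1 - cos t))]

lemma norm_tsum_mul_exp_le {w : ℕ → ℝ} (hw : ∀ k, 0 ≤ w k) (hs : HasSum w 1) (t : ℝ) :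
    ‖∑' k : ℕ, (w k : ℂ) * Complex.exp (Complex.I * (k : ℂ) * (t : ℂ))‖
      ≤ 1 - w 0 * w 1 * (1 - cos t) := by
  set f : ℕ → ℂ := fun k => (w k : ℂ) * Complex.exp (Complex.I * (k : ℂ) * (t : ℂ)) with hf
  have hnorm : ∀ k, ‖f k‖ = w k := by
    intro k
    have : Complex.I * (k : ℂ) * (t : ℂ) = ((k * t : ℝ) : ℂ) * Complex.I := by
      push_cast; ring
    simp only [hf]
    rw [norm_mul, this, Complex.norm_exp_ofReal_mul_I, mul_one, Complex.norm_real,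
      Real.norm_of_nonneg (hw k)]
  have hsn : Summable fun k => ‖f k‖ := by simpa only [hnorm] using hs.summable
  have htail : w 0 + w 1 + ∑' k, w (k + 2) = 1 := by
    have h := hs.summable.sum_add_tsum_nat_add 2
    rwa [hs.tsum_eq, Finset.sum_range_succ, Finset.sum_range_one] at h
  have htail0 : 0 ≤ ∑' k, w (k + 2) := tsum_nonneg fun k => hw _
  have hrest : ‖∑' k, f (k + 2)‖ ≤ ∑' k, w (k + 2) := by
    have h := norm_tsum_le_tsum_norm (f := fun k => f (k + 2))
      ((summable_nat_add_iff (f := fun k => ‖f k‖) 2).2 hsn)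
    simpa only [hnorm] using h
  have hhead := norm_add_mul_exp_le (hw 0) (hw 1) (by linarith) t
  have hhead_eq : ∑ k ∈ Finset.range 2, f k = (w 0 : ℂ) + w 1 * Complex.exp (Complex.I * t) := by
    simp [Finset.sum_range_succ, hf]
  rw [← hsn.of_norm.sum_add_tsum_nat_add 2, hhead_eq]
  refine (norm_add_le _ _).trans ?_
  linarith

/-- Uniform characteristic-function gap for the one-site equilibria: for `g`
with the gap condition, `0 < λ₀ ≤ λ₁` and `δ ∈ (0, π]`, there is `β ∈ (0,1)` such that for every
`λ ∈ [λ₀, λ₁]` and every `t` with `δ ≤ |t| ≤ π`, `|Σ_k n_λ(k) e^{ikt}|² ≤ 1 − β`. -/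
theorem zrp_characteristic_function_gap (g : ℕ → ℝ) (hg0 : g 0 = 0)
    (hgpos : ∀ k : ℕ, 0 < k → 0 < g k) (hgap : GapCondition g)
    (lam0 lam1 : ℝ) (hlam0 : 0 < lam0) (hlam : lam0 ≤ lam1)
    (δ : ℝ) (hδ : 0 < δ) (hδπ : δ ≤ Real.pi) :
    ∃ β ∈ Set.Ioo (0:ℝ) 1, ∀ lam ∈ Set.Icc lam0 lam1, ∀ t : ℝ,
      δ ≤ |t| → |t| ≤ Real.pi →
      ‖∑' k : ℕ, (nWeight g lam k : ℂ) * Complex.exp (Complex.I * (k : ℂ) * (t : ℂ))‖ ^ 2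
        ≤ 1 - β := by
  have hg := hgap.tendsto_atTop hg0
  have hsum : ∀ {l : ℝ}, 0 < l → Summable fun k : ℕ => l ^ k / gFact g k :=
    fun hl => summable_pow_div_gFact hgpos hg hl
  have hZpos : ∀ {l : ℝ}, 0 < l → 0 < Zfun g l := fun {l} hl =>
    (hsum hl).tsum_pos (fun k => (div_pos (pow_pos hl k) (gFact_pos hgpos k)).le) 0
      (div_pos (pow_pos hl 0) (gFact_pos hgpos 0))
  have hlam1 : 0 < lam1 := hlam0.trans_le hlam
  have hZ1 := hZpos hlam1
  have hg1 : 0 < g 1 := hgpos 1 one_pos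
  have hcosδ : cos δ < 1 := by
    simpa using cos_lt_cos_of_nonneg_of_le_pi le_rfl hδπ hδ
  set c : ℝ := 1 / Zfun g lam1 * (lam0 / (g 1 * Zfun g lam1)) * (1 - cos δ) with hc
  have hcpos : 0 < c := mul_pos (by positivity) (by linarith)
  refine ⟨min c (1 / 2), ⟨by positivity, (min_le_right _ _).trans_lt (by norm_num)⟩, ?_⟩
  rintro lam ⟨hl0, hl1⟩ t ht htπ
  have hl : 0 < lam := hlam0.trans_le hl0
  have hZ := hZpos hl
  have hZle : Zfun g lam ≤ Zfun g lam1 :=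
    (hsum hl).tsum_le_tsum (fun k => by
      have := gFact_pos hgpos k
      gcongr) (hsum hlam1)
  have hw : ∀ k, 0 ≤ nWeight g lam k := fun k =>
    (div_pos (pow_pos hl k) (mul_pos (gFact_pos hgpos k) hZ)).le
  have hs : HasSum (nWeight g lam) 1 := by
    have h := (hsum hl).hasSum.div_const (Zfun g lam)
    rw [show ∑' k : ℕ, lam ^ k / gFact g k = Zfun g lam from rfl, div_self hZ.ne'] at h
    exact h.congr_fun fun k => by rw [nWeight, div_div]
  have hcos : cos t ≤ cos δ := by
    rw [← cos_abs t]
    exact cos_le_cos_of_nonneg_of_le_pi hδ.le htπ ht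
  have hgap_le : c ≤ nWeight g lam 0 * nWeight g lam 1 * (1 - cos t) := by
    have h0 : nWeight g lam 0 = 1 / Zfun g lam := by simp [nWeight, gFact]
    have h1 : nWeight g lam 1 = lam / (g 1 * Zfun g lam) := by simp [nWeight, gFact]
    rw [h0, h1, hc]
    have : 0 ≤ 1 - cos δ := by linarith
    gcongr
  have hS := norm_tsum_mul_exp_le hw hs t
  set S := ‖∑' k : ℕ, (nWeight g lam k : ℂ) * Complex.exp (Complex.I * (k : ℂ) * (t : ℂ))‖
  have hS0 : 0 ≤ S := norm_nonneg _
  have := min_le_left c (1 / 2)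
  nlinarith
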